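/- arXiv:2511.11488 — 7 statements merged into one kernel-verified Lean document; each statement's English description precedes it below -/
import Mathlib

section
/- For all n ≥ 0, every job waiting in the OR system is also waiting in the UB system: 𝒬₁⁻(n) ⊆ 𝒬̂₁⁻(n), 𝒬₁⁺(n) ⊆ 𝒬̂₁⁺(n), and 𝒬₂(n) ⊆ 𝒬̂₂(n). -/
/-!
Discrete-event coupled N-model with a deterministic waiting-time threshold `T` on
the diagonal.  Events are indexed `1, 2, 3, …` and occur at strictly increasing
times `t 1 < t 2 < …`.  Jobs are identified with the index of their arrival event.
The five kinds of events are: a type-1 arrival, a type-2 arrival, the waiting time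
of the type-1 job that arrived at event `k` reaching the threshold `T`, a potential
service completion at server 1, and a potential service completion at server 2.
-/

inductive NEvent : Type
  /-- (i) arrival of a new type-1 job -/
  | arr1 : NEvent
  /-- (ii) arrival of a new type-2 job -/
  | arr2 : NEvent
  /-- (iii) the waiting time of the type-1 job that arrived at event `k` reaches `T` -/
  | thresh : ℕ → NEvent
  /-- (iv) a potential service completion at server 1 -/
  | dep1 : NEvent
  /-- (v) a potential service completion at server 2 -/
  | dep2 : NEvent
  deriving DecidableEq

/-- The state of one of the two systems after an event: the set `q1m` of waiting
type-1 jobs with current waiting time `< T`, the set `q1p` of waiting type-1 jobs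
with waiting time `≥ T`, the set `q2` of waiting type-2 jobs (all recorded by the
index of the job's arrival event; smaller index = earlier arrival), and the jobs
(if any) in service at server 1 and at server 2. -/
structure NState : Type where
  q1m : Finset ℕ
  q1p : Finset ℕ
  q2 : Finset ℕ
  s1 : Option ℕ
  s2 : Option ℕ

/-- Both systems start empty. -/
def NState.empty : NState := ⟨∅, ∅, ∅, none, none⟩

/-- Transition of the OR system at event index `n` .
Server 1 may serve any waiting type-1 job; server 2 may serve waiting type-2 jobs
and waiting type-1 jobs whose waiting time is at least `T` (i.e. members of `q1p`).
Servers are non-idling and FCFS: an idle server immediately takes the eligible job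
with the earliest arrival (= least index); at a potential service completion the job
in service (if any) departs and the freed server takes the earliest eligible waiting job. -/
def orStep (n : ℕ) (ev : NEvent) (s : NState) : NState :=
  match ev with
  | NEvent.arr1 =>
      if s.s1 = none ∧ s.q1m = ∅ ∧ s.q1p = ∅ then { s with s1 := some n }
      else { s with q1m := insert n s.q1m }
  | NEvent.arr2 =>
      if s.s2 = none ∧ s.q1p = ∅ ∧ s.q2 = ∅ then { s with s2 := some n }
      else { s with q2 := insert n s.q2 }
  | NEvent.thresh k =>
      if k ∈ s.q1m then
        let s' : NState := { s with q1m := s.q1m.erase k }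
        if s'.s2 = none ∧ s'.q1p = ∅ ∧ s'.q2 = ∅ then { s' with s2 := some k }
        else if s'.s1 = none ∧ s'.q1p = ∅ then { s' with s1 := some k }
        else { s' with q1p := insert k s'.q1p }
      else s
  | NEvent.dep1 =>
      match s.s1 with
      | none => s
      | some _ =>
          if h : (s.q1m ∪ s.q1p).Nonempty then
            let j := (s.q1m ∪ s.q1p).min' h
            { s with s1 := some j, q1m := s.q1m.erase j, q1p := s.q1p.erase j }
          else { s with s1 := none }
  | NEvent.dep2 =>
      match s.s2 with
      | none => s
      | some _ =>
          if h : (s.q1p ∪ s.q2).Nonempty then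
            let j := (s.q1p ∪ s.q2).min' h
            { s with s2 := some j, q1p := s.q1p.erase j, q2 := s.q2.erase j }
          else { s with s2 := none }

/-- Transition of the UB system at event index `n`.  Identical to the OR system,
except that server 1, too, may take a type-1 job into service only once that job's
waiting time is at least `T` (so a type-1 arrival always joins `q1m`, and server 1
serves only jobs of `q1p`), and a type-1 job reaching waiting time `T` that finds
both servers idle is taken into service by server 1. -/
def ubStep (n : ℕ) (ev : NEvent) (s : NState) : NState :=
  match ev with
  | NEvent.arr1 => { s with q1m := insert n s.q1m }
  | NEvent.arr2 =>
      if s.s2 = none ∧ s.q1p = ∅ ∧ s.q2 = ∅ then { s with s2 := some n }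
      else { s with q2 := insert n s.q2 }
  | NEvent.thresh k =>
      if k ∈ s.q1m then
        let s' : NState := { s with q1m := s.q1m.erase k }
        if s'.s1 = none ∧ s'.q1p = ∅ then { s' with s1 := some k }
        else if s'.s2 = none ∧ s'.q1p = ∅ ∧ s'.q2 = ∅ then { s' with s2 := some k }
        else { s' with q1p := insert k s'.q1p }
      else s
  | NEvent.dep1 =>
      match s.s1 with
      | none => s
      | some _ =>
          if h : s.q1p.Nonempty then
            let j := s.q1p.min' h
            { s with s1 := some j, q1p := s.q1p.erase j }
          else { s with s1 := none }
  | NEvent.dep2 =>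
      match s.s2 with
      | none => s
      | some _ =>
          if h : (s.q1p ∪ s.q2).Nonempty then
            let j := (s.q1p ∪ s.q2).min' h
            { s with s2 := some j, q1p := s.q1p.erase j, q2 := s.q2.erase j }
          else { s with s2 := none }

/-- A driving sequence for the coupled N-model: a threshold `T > 0`, strictly
increasing positive event times `t 1 < t 2 < …` (with `t 0 = 0` as a convention;
index `0` carries no event), and events `e 1, e 2, …` such that a threshold event
`thresh k` at event index `n` says the type-1 job that arrived at event `k`
(at time `t n - T`) reaches waiting time `T`, and every type-1 arrival has exactly
one threshold event, `T` time units after its arrival (uniqueness is automatic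
from `t n = t k + T` and strict monotonicity of the times). -/
structure NDriving : Type where
  T : ℝ
  hT : 0 < T
  t : ℕ → ℝ
  e : ℕ → NEvent
  ht0 : t 0 = 0
  hmono : StrictMono t
  hthresh : ∀ n k, 1 ≤ n → e n = NEvent.thresh k →
      1 ≤ k ∧ k < n ∧ e k = NEvent.arr1 ∧ t n = t k + T
  hthresh_ex : ∀ k, 1 ≤ k → e k = NEvent.arr1 → ∃ n, 1 ≤ n ∧ e n = NEvent.thresh k

/-- The state of the OR system after `n` events (`n = 0` is the empty initial state). -/
def orTraj (D : NDriving) : ℕ → NState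
  | 0 => NState.empty
  | n + 1 => orStep (n + 1) (D.e (n + 1)) (orTraj D n)

/-- The state of the UB system after `n` events. -/
def ubTraj (D : NDriving) : ℕ → NState
  | 0 => NState.empty
  | n + 1 => ubStep (n + 1) (D.e (n + 1)) (ubTraj D n)

/-- `Q₁⁻(n)`: number of waiting type-1 jobs with waiting time `< T` in the OR system. -/
def orQ1m (D : NDriving) (n : ℕ) : ℕ := (orTraj D n).q1m.card

/-- `Q₁⁺(n)`: number of waiting type-1 jobs with waiting time `≥ T` in the OR system. -/
def orQ1p (D : NDriving) (n : ℕ) : ℕ := (orTraj D n).q1p.card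

/-- `Q₂(n)`: number of waiting type-2 jobs in the OR system. -/
def orQ2 (D : NDriving) (n : ℕ) : ℕ := (orTraj D n).q2.card

/-- `Q₁(n) = Q₁⁻(n) + Q₁⁺(n)`. -/
def orQ1 (D : NDriving) (n : ℕ) : ℕ := orQ1m D n + orQ1p D n

/-- `R₁(n) ∈ {0,1}`: 1 iff server 1 of the OR system is busy. -/
def orR1 (D : NDriving) (n : ℕ) : ℕ := if (orTraj D n).s1 = none then 0 else 1

/-- `R₂(n) ∈ {0,1}`: 1 iff server 2 of the OR system is busy serving a type-2 job. -/
def orR2 (D : NDriving) (n : ℕ) : ℕ :=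
  match (orTraj D n).s2 with
  | none => 0
  | some j => if D.e j = NEvent.arr2 then 1 else 0

/-- `R₃(n) ∈ {0,1}`: 1 iff server 2 of the OR system is busy serving a type-1 job. -/
def orR3 (D : NDriving) (n : ℕ) : ℕ :=
  match (orTraj D n).s2 with
  | none => 0
  | some j => if D.e j = NEvent.arr1 then 1 else 0

/-- `Q̂₁⁻(n)` for the UB system. -/
def ubQ1m (D : NDriving) (n : ℕ) : ℕ := (ubTraj D n).q1m.card

/-- `Q̂₁⁺(n)` for the UB system. -/
def ubQ1p (D : NDriving) (n : ℕ) : ℕ := (ubTraj D n).q1p.card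

/-- `Q̂₂(n)` for the UB system. -/
def ubQ2 (D : NDriving) (n : ℕ) : ℕ := (ubTraj D n).q2.card

/-- `Q̂₁(n) = Q̂₁⁻(n) + Q̂₁⁺(n)`. -/
def ubQ1 (D : NDriving) (n : ℕ) : ℕ := ubQ1m D n + ubQ1p D n

/-- `R̂₁(n)` for the UB system. -/
def ubR1 (D : NDriving) (n : ℕ) : ℕ := if (ubTraj D n).s1 = none then 0 else 1

/-- `R̂₂(n)` for the UB system. -/
def ubR2 (D : NDriving) (n : ℕ) : ℕ :=
  match (ubTraj D n).s2 with
  | none => 0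
  | some j => if D.e j = NEvent.arr2 then 1 else 0

/-- `R̂₃(n)` for the UB system. -/
def ubR3 (D : NDriving) (n : ℕ) : ℕ :=
  match (ubTraj D n).s2 with
  | none => 0
  | some j => if D.e j = NEvent.arr1 then 1 else 0

theorem exists_eq_min' (S : Finset ℕ) :
    ∃ a, (∀ h, S.min' h = a) ∧ (S = ∅ ∨ a ∈ S ∧ ∀ x ∈ S, a ≤ x) := by
  obtain rfl | h := S.eq_empty_or_nonempty
  · exact ⟨0, by simp, .inl rfl⟩
  · exact ⟨S.min' h, fun _ => rfl, .inr ⟨S.min'_mem h, fun x hx => S.min'_le x hx⟩⟩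

/-- The coupling invariant between a state `o` of the OR system and a state `u` of the
UB system after `n` events. -/
structure Coupled (n : ℕ) (o u : NState) : Prop where
  q1m_subset : o.q1m ⊆ u.q1m
  q1p_subset : o.q1p ⊆ u.q1p
  q2_subset : o.q2 ⊆ u.q2
  or_idle1 : o.s1 = none → o.q1m = ∅ ∧ o.q1p = ∅
  or_idle2 : o.s2 = none → o.q1p = ∅ ∧ o.q2 = ∅
  ub_idle1 : u.s1 = none → u.q1p = ∅
  ub_idle2 : u.s2 = none → u.q1p = ∅ ∧ u.q2 = ∅
  idle2 : u.s2 = none → o.s2 = none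
  idle1 : ∀ j, o.s1 = some j → u.s1 = none → j ∈ u.q1m
  q1p_lt_q1m : ∀ x ∈ u.q1p, ∀ y ∈ u.q1m, x < y
  s1_lt_q1m : ∀ j, o.s1 = some j → ∀ y ∈ o.q1m, j < y
  q1m_le : ∀ x ∈ u.q1m, x ≤ n
  q1p_le : ∀ x ∈ u.q1p, x ≤ n
  s1_le : ∀ j, o.s1 = some j → j ≤ n

namespace Coupled

variable {n : ℕ} {o u : NState}

theorem arr1 (h : Coupled n o u) :
    Coupled (n + 1) (orStep (n + 1) .arr1 o) (ubStep (n + 1) .arr1 u) := by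
  obtain ⟨a1, a2, a3, b1, b2, c1, c2, d2, d1, e1, e2, f1, f2, f3⟩ := h
  simp only [orStep, ubStep]
  split <;> constructor <;> grind

theorem arr2 (h : Coupled n o u) :
    Coupled (n + 1) (orStep (n + 1) .arr2 o) (ubStep (n + 1) .arr2 u) := by
  obtain ⟨a1, a2, a3, b1, b2, c1, c2, d2, d1, e1, e2, f1, f2, f3⟩ := h
  simp only [orStep, ubStep]
  split <;> split <;> constructor <;> grind

theorem thresh (h : Coupled n o u) {k : ℕ} (hk : ∀ x ∈ u.q1m, k ≤ x) :
    Coupled (n + 1) (orStep (n + 1) (.thresh k) o) (ubStep (n + 1) (.thresh k) u) := by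
  obtain ⟨a1, a2, a3, b1, b2, c1, c2, d2, d1, e1, e2, f1, f2, f3⟩ := h
  have hbusy : k ∈ o.q1m → u.s1 ≠ none ∧ o.s1 ≠ none := by
    intro hko
    obtain hs | ⟨j, hj⟩ : o.s1 = none ∨ ∃ j, o.s1 = some j := by
      cases o.s1 <;> simp
    · grind
    · exact ⟨fun hu => absurd (hk j (d1 j hj hu)) (not_le.mpr (e2 j hj k hko)), by simp [hj]⟩
  simp only [orStep, ubStep]
  split_ifs <;> constructor <;> grind

theorem dep1 (h : Coupled n o u) :
    Coupled (n + 1) (orStep (n + 1) .dep1 o) (ubStep (n + 1) .dep1 u) := by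
  obtain ⟨a1, a2, a3, b1, b2, c1, c2, d2, d1, e1, e2, f1, f2, f3⟩ := h
  obtain ⟨a, ha, ha'⟩ := exists_eq_min' (o.q1m ∪ o.q1p)
  obtain ⟨b, hb, hb'⟩ := exists_eq_min' (u.q1p)
  simp only [orStep, ubStep, ha, hb, Finset.nonempty_iff_ne_empty, ne_eq,
    Finset.union_eq_empty]
  clear ha hb
  simp only [Finset.union_eq_empty, Finset.mem_union, or_imp, forall_and] at ha'
  cases ho : o.s1 <;> cases hu : u.s1 <;> dsimp only <;> (try split_ifs) <;>
    constructor <;> grind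

theorem dep2 (h : Coupled n o u) :
    Coupled (n + 1) (orStep (n + 1) .dep2 o) (ubStep (n + 1) .dep2 u) := by
  obtain ⟨a1, a2, a3, b1, b2, c1, c2, d2, d1, e1, e2, f1, f2, f3⟩ := h
  obtain ⟨a, ha, ha'⟩ := exists_eq_min' (o.q1p ∪ o.q2)
  obtain ⟨b, hb, hb'⟩ := exists_eq_min' (u.q1p ∪ u.q2)
  simp only [orStep, ubStep, ha, hb, Finset.nonempty_iff_ne_empty, ne_eq,
    Finset.union_eq_empty]
  clear ha hb
  simp only [Finset.union_eq_empty, Finset.mem_union, or_imp, forall_and] at ha' hb'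
  cases ho : o.s2 <;> cases hu : u.s2 <;> dsimp only <;> (try split_ifs) <;>
    constructor <;> grind

end Coupled

/-- A waiting job of `q1m` in the UB system is a type-1 job that has not yet reached the
threshold. -/
theorem ubTraj_q1m_spec (D : NDriving) (n : ℕ) :
    ∀ x ∈ (ubTraj D n).q1m, 1 ≤ x ∧ D.e x = .arr1 ∧
      ∀ m, 1 ≤ m → m ≤ n → D.e m ≠ .thresh x := by
  induction n with
  | zero => simp [ubTraj, NState.empty]
  | succ n ih =>
    intro x hx
    simp only [ubTraj, ubStep] at hx
    have hstep : (x ∈ (ubTraj D n).q1m ∧ D.e (n + 1) ≠ .thresh x) ∨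
        (x = n + 1 ∧ D.e (n + 1) = .arr1) := by
      cases he : D.e (n + 1) <;> simp only [he] at hx <;> grind
    obtain ⟨hx, hne⟩ | ⟨rfl, he⟩ := hstep
    · obtain ⟨h1, h2, h3⟩ := ih x hx
      refine ⟨h1, h2, fun m hm hmn => ?_⟩
      obtain rfl | hlt := hmn.eq_or_lt
      · exact hne
      · exact h3 m hm (Nat.lt_succ_iff.mp hlt)
    · refine ⟨by omega, he, fun m hm hmn hmx => ?_⟩
      have := (D.hthresh m _ hm hmx).2.1
      omega

/-- The job whose threshold is reached is the oldest one that has not reached it before. -/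
theorem ubTraj_q1m_ge_of_thresh (D : NDriving) {n k : ℕ} (hk : D.e (n + 1) = .thresh k) :
    ∀ x ∈ (ubTraj D n).q1m, k ≤ x := by
  intro x hx
  obtain ⟨h1, h2, h3⟩ := ubTraj_q1m_spec D n x hx
  obtain ⟨m, hm, hmx⟩ := D.hthresh_ex x h1 h2
  have hmn : n + 1 ≤ m := by
    by_contra hlt
    exact h3 m hm (by omega) hmx
  have hmt := (D.hthresh m x hm hmx).2.2.2
  have hnt := (D.hthresh (n + 1) k (by omega) hk).2.2.2
  have := D.hmono.monotone hmn
  exact D.hmono.le_iff_le.mp (by linarith)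

theorem coupled_traj (D : NDriving) (n : ℕ) : Coupled n (orTraj D n) (ubTraj D n) := by
  induction n with
  | zero => constructor <;> simp [orTraj, ubTraj, NState.empty]
  | succ n ih =>
    simp only [orTraj, ubTraj]
    cases he : D.e (n + 1) with
    | arr1 => exact ih.arr1
    | arr2 => exact ih.arr2
    | thresh k => exact ih.thresh (ubTraj_q1m_ge_of_thresh D he)
    | dep1 => exact ih.dep1
    | dep2 => exact ih.dep2

/-- For all `n ≥ 0`, every job waiting in the OR system is also waiting in the UB
system: `𝒬₁⁻(n) ⊆ 𝒬̂₁⁻(n)`, `𝒬₁⁺(n) ⊆ 𝒬̂₁⁺(n)`, and `𝒬₂(n) ⊆ 𝒬̂₂(n)`. -/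
theorem waiting_subsets (D : NDriving) (n : ℕ) :
    (orTraj D n).q1m ⊆ (ubTraj D n).q1m ∧
    (orTraj D n).q1p ⊆ (ubTraj D n).q1p ∧
    (orTraj D n).q2 ⊆ (ubTraj D n).q2 := by
  have h := coupled_traj D n
  exact ⟨h.q1m_subset, h.q1p_subset, h.q2_subset⟩
end

section
/- Suppose the n-th event e_n is of type (iii) for a type-1 job c, i.e. c arrived at time t_n − T. If c ∈ 𝒬₁⁻(n−1) (c is still waiting in the OR system just before this event), then 𝒬₁⁻(n−1) = 𝒬̂₁⁻(n−1); in particular Q₁⁻(n−1) = Q̂₁⁻(n−1). -/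
/-- The pre-threshold queue of the UB system after one step: server 1 never takes a job out of it. -/
theorem ubStep_q1m (n : ℕ) (ev : NEvent) (s : NState) :
    (ubStep n ev s).q1m = match ev with
      | NEvent.arr1 => insert n s.q1m
      | NEvent.thresh k => s.q1m.erase k
      | _ => s.q1m := by
  rcases ev with _ | _ | k | _ | _ <;> simp only [ubStep]
  · split_ifs <;> rfl
  · split_ifs with hk
    · rfl
    · rfl
    · rfl
    · exact (Finset.erase_eq_of_notMem hk).symm
  · cases s.s1
    · rfl
    · dsimp only; split_ifs <;> rfl
  · cases s.s2
    · rfl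
    · dsimp only; split_ifs <;> rfl

theorem orStep_arr1_q1m (n : ℕ) (s : NState) :
    (s.q1m = ∅ ∧ (orStep n NEvent.arr1 s).q1m = ∅) ∨
      (orStep n NEvent.arr1 s).q1m = insert n s.q1m := by
  simp only [orStep]
  split_ifs with h
  · exact Or.inl ⟨h.2.1, h.2.1⟩
  · exact Or.inr rfl

theorem orStep_arr2_q1m (n : ℕ) (s : NState) : (orStep n NEvent.arr2 s).q1m = s.q1m := by
  simp only [orStep]
  split_ifs <;> rfl

theorem orStep_thresh_q1m (n k : ℕ) (s : NState) :
    (orStep n (NEvent.thresh k) s).q1m = s.q1m.erase k := by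
  simp only [orStep]
  split_ifs with hk
  · rfl
  · rfl
  · rfl
  · exact (Finset.erase_eq_of_notMem hk).symm

/-- A potential completion at server 1 removes at most one job `j`, no later than all others,
from the pre-threshold queue of the OR system. -/
theorem orStep_dep1_q1m (n : ℕ) (s : NState) :
    (orStep n NEvent.dep1 s).q1m = s.q1m ∨
      ∃ j, (∀ k ∈ s.q1m, j ≤ k) ∧ (orStep n NEvent.dep1 s).q1m = s.q1m.erase j := by
  simp only [orStep]
  cases s.s1 with
  | none => exact Or.inl rfl
  | some _ =>
    dsimp only
    split_ifs with h
    · exact Or.inr ⟨_, fun k hk => Finset.min'_le _ _ (Finset.mem_union_left _ hk), rfl⟩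
    · exact Or.inl rfl

theorem orStep_dep2_q1m (n : ℕ) (s : NState) : (orStep n NEvent.dep2 s).q1m = s.q1m := by
  simp only [orStep]
  cases s.s2
  · rfl
  · dsimp only; split_ifs <;> rfl

/-- Jobs in the UB pre-threshold queue are type-1 jobs that have arrived and whose threshold
event has not yet occurred. -/
theorem of_mem_ubTraj_q1m (D : NDriving) {n j : ℕ} (hj : j ∈ (ubTraj D n).q1m) :
    1 ≤ j ∧ j ≤ n ∧ D.e j = NEvent.arr1 ∧
      ∀ m, 1 ≤ m → m ≤ n → D.e m ≠ NEvent.thresh j := by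
  induction n with
  | zero => simp [ubTraj, NState.empty] at hj
  | succ n ih =>
    have old (h : j ∈ (ubTraj D n).q1m) (hne : D.e (n + 1) ≠ NEvent.thresh j) :
        1 ≤ j ∧ j ≤ n + 1 ∧ D.e j = NEvent.arr1 ∧
          ∀ m, 1 ≤ m → m ≤ n + 1 → D.e m ≠ NEvent.thresh j := by
      obtain ⟨h1, h2, h3, h4⟩ := ih h
      refine ⟨h1, by omega, h3, fun m hm hmn => ?_⟩
      rcases Nat.le_succ_iff.1 hmn with h | rfl
      · exact h4 m hm h
      · exact hne
    rw [ubTraj, ubStep_q1m] at hj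
    cases he : D.e (n + 1) with
    | arr1 =>
      simp only [he, Finset.mem_insert] at hj
      rcases hj with rfl | hj
      · refine ⟨by omega, le_rfl, he, fun m hm hmn h => ?_⟩
        have := (D.hthresh m _ hm h).2.1
        omega
      · exact old hj (by simp [he])
    | thresh k =>
      simp only [he, Finset.mem_erase] at hj
      exact old hj.2 (by simpa [he] using hj.1.symm)
    | arr2 => simp only [he] at hj; exact old hj (by simp [he])
    | dep1 => simp only [he] at hj; exact old hj (by simp [he])
    | dep2 => simp only [he] at hj; exact old hj (by simp [he])

/-- By FCFS, the OR pre-threshold queue is a final segment (in order of arrival) of the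
UB pre-threshold queue. -/
theorem orTraj_q1m_final_segment (D : NDriving) (n : ℕ) :
    (orTraj D n).q1m ⊆ (ubTraj D n).q1m ∧
      ∀ k ∈ (orTraj D n).q1m, ∀ j ∈ (ubTraj D n).q1m, k ≤ j → j ∈ (orTraj D n).q1m := by
  induction n with
  | zero => simp [orTraj, NState.empty]
  | succ n ih =>
    have hle (j : ℕ) (hj : j ∈ (ubTraj D n).q1m) : j ≤ n := (of_mem_ubTraj_q1m D hj).2.1
    rw [orTraj, ubTraj, ubStep_q1m]
    generalize orTraj D n = s at *
    generalize ubTraj D n = u at *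
    obtain ⟨hsub, hup⟩ := ih
    cases D.e (n + 1) with
    | arr1 =>
      rcases orStep_arr1_q1m (n + 1) s with ⟨-, h⟩ | h
      · simp [h]
      · rw [h]
        refine ⟨Finset.insert_subset_insert _ hsub, ?_⟩
        simp only [Finset.mem_insert]
        rintro k hk j (rfl | hj) hkj
        · exact Or.inl rfl
        · rcases hk with rfl | hk
          · have := hle j hj
            omega
          · exact Or.inr (hup k hk j hj hkj)
    | thresh k =>
      rw [orStep_thresh_q1m]
      refine ⟨Finset.erase_subset_erase _ hsub, ?_⟩
      simp only [Finset.mem_erase]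
      exact fun i hi j hj hij => ⟨hj.1, hup i hi.2 j hj.2 hij⟩
    | arr2 => rw [orStep_arr2_q1m]; exact ⟨hsub, hup⟩
    | dep1 =>
      rcases orStep_dep1_q1m (n + 1) s with h | ⟨i, hi, h⟩
      · rw [h]; exact ⟨hsub, hup⟩
      · rw [h]
        refine ⟨(Finset.erase_subset _ _).trans hsub, ?_⟩
        simp only [Finset.mem_erase]
        rintro k ⟨hki, hk⟩ j hj hkj
        have := hi k hk
        exact ⟨by omega, hup k hk j hj hkj⟩
    | dep2 => rw [orStep_dep2_q1m]; exact ⟨hsub, hup⟩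

/-- The job whose threshold event comes next arrived no later than any other job in the
UB pre-threshold queue. -/
theorem le_of_mem_ubTraj_q1m (D : NDriving) {n c j : ℕ}
    (hev : D.e (n + 1) = NEvent.thresh c) (hj : j ∈ (ubTraj D n).q1m) : c ≤ j := by
  obtain ⟨h1, -, harr, hno⟩ := of_mem_ubTraj_q1m D hj
  obtain ⟨m, hm, hem⟩ := D.hthresh_ex j h1 harr
  have hmn : n + 1 ≤ m := by
    by_contra! h
    exact hno m hm (by omega) hem
  have htm := (D.hthresh m j hm hem).2.2.2
  have htn := (D.hthresh (n + 1) c (by omega) hev).2.2.2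
  have := D.hmono.monotone hmn
  exact D.hmono.le_iff_le.1 (by linarith)

/-- Suppose the `(n+1)`-th event is the threshold crossing of a type-1 job `c`
(i.e. `c` arrived at time `t (n+1) - T`).  If `c ∈ 𝒬₁⁻(n)`, i.e. `c` is still
waiting in the OR system just before this event, then `𝒬₁⁻(n) = 𝒬̂₁⁻(n)`; in
particular `Q₁⁻(n) = Q̂₁⁻(n)`. -/
theorem preThreshold_queues_eq_of_waiting (D : NDriving) (n c : ℕ)
    (hev : D.e (n + 1) = NEvent.thresh c)
    (hc : c ∈ (orTraj D n).q1m) :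
    (orTraj D n).q1m = (ubTraj D n).q1m ∧ orQ1m D n = ubQ1m D n := by
  obtain ⟨hsub, hup⟩ := orTraj_q1m_final_segment D n
  have h : (orTraj D n).q1m = (ubTraj D n).q1m :=
    hsub.antisymm fun j hj => hup c hc j hj (le_of_mem_ubTraj_q1m D hev hj)
  exact ⟨h, congrArg Finset.card h⟩
end

section
/- For all n ≥ 0, the total number of waiting jobs in the OR system is at most that in the UB system: Q₁(n) + Q₂(n) ≤ Q̂₁(n) + Q̂₂(n). -/
theorem min'_union_mem_and_le (q r : Finset ℕ) (h : (q ∪ r).Nonempty) :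
    ((q ∪ r).min' h ∈ q ∨ (q ∪ r).min' h ∈ r) ∧
      (∀ b ∈ q, (q ∪ r).min' h ≤ b) ∧ ∀ b ∈ r, (q ∪ r).min' h ≤ b :=
  ⟨Finset.mem_union.mp (Finset.min'_mem _ h),
    fun _ hb => Finset.min'_le _ _ (Finset.mem_union_left _ hb),
    fun _ hb => Finset.min'_le _ _ (Finset.mem_union_right _ hb)⟩

/-- The coupling invariant: after `n` events, the OR state `s` is dominated by the UB state `u`. -/
structure NState.Dominated (n : ℕ) (s u : NState) : Prop where
  q1m_subset : s.q1m ⊆ u.q1m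
  q1p_subset : s.q1p ⊆ u.q1p
  q2_subset : s.q2 ⊆ u.q2
  or_s1_nonidling : s.s1 = none → s.q1m = ∅ ∧ s.q1p = ∅
  or_s2_nonidling : s.s2 = none → s.q1p = ∅ ∧ s.q2 = ∅
  ub_s1_nonidling : u.s1 = none → u.q1p = ∅
  ub_s2_nonidling : u.s2 = none → u.q1p = ∅ ∧ u.q2 = ∅
  s2_idle : u.s2 = none → s.s2 = none
  s1_idle : u.s1 = none → ∀ j, s.s1 = some j → j ∈ u.q1m
  q1p_lt_q1m : ∀ a ∈ s.q1p, ∀ b ∈ u.q1m, a < b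
  s1_lt_q1m : ∀ j, s.s1 = some j → ∀ b ∈ s.q1m, j < b
  q1m_le : ∀ b ∈ u.q1m, b ≤ n
  q1p_le : ∀ a ∈ s.q1p, a ≤ n
  s1_le : ∀ j, s.s1 = some j → j ≤ n

namespace NState.Dominated

variable {n : ℕ} {s u : NState}

theorem arr1 (h : Dominated n s u) :
    Dominated (n + 1) (orStep (n + 1) .arr1 s) (ubStep (n + 1) .arr1 u) := by
  obtain ⟨h1, h2, h3, h4, h5, h6, h7, h8, h9, h10, h11, h12, h13, h14⟩ := h
  simp only [orStep, ubStep]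
  split_ifs <;> constructor <;> grind

theorem arr2 (h : Dominated n s u) :
    Dominated (n + 1) (orStep (n + 1) .arr2 s) (ubStep (n + 1) .arr2 u) := by
  obtain ⟨h1, h2, h3, h4, h5, h6, h7, h8, h9, h10, h11, h12, h13, h14⟩ := h
  simp only [orStep, ubStep]
  split_ifs <;> constructor <;> grind

theorem thresh {k : ℕ} (h : Dominated n s u) (hk : ∀ b ∈ u.q1m, k ≤ b) :
    Dominated (n + 1) (orStep (n + 1) (.thresh k) s) (ubStep (n + 1) (.thresh k) u) := by
  obtain ⟨h1, h2, h3, h4, h5, h6, h7, h8, h9, h10, h11, h12, h13, h14⟩ := h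
  have hs1 : k ∈ s.q1m → u.s1 ≠ none := by
    intro hks hu
    cases hj : s.s1 <;> grind
  simp only [orStep, ubStep]
  split_ifs <;> constructor <;> grind

theorem dep1 (h : Dominated n s u) :
    Dominated (n + 1) (orStep (n + 1) .dep1 s) (ubStep (n + 1) .dep1 u) := by
  obtain ⟨h1, h2, h3, h4, h5, h6, h7, h8, h9, h10, h11, h12, h13, h14⟩ := h
  have hor := min'_union_mem_and_le s.q1m s.q1p
  have hub (hq : u.q1p.Nonempty) : u.q1p.min' hq ∈ u.q1p ∧ ∀ b ∈ u.q1p, u.q1p.min' hq ≤ b :=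
    ⟨u.q1p.min'_mem hq, u.q1p.min'_le⟩
  simp only [orStep, ubStep]
  cases hs : s.s1 <;> cases hu : u.s1 <;> simp only [] <;> (try split_ifs) <;>
    constructor <;> grind [Finset.not_nonempty_iff_eq_empty, Finset.union_eq_empty, Finset.erase_empty]

theorem dep2 (h : Dominated n s u) :
    Dominated (n + 1) (orStep (n + 1) .dep2 s) (ubStep (n + 1) .dep2 u) := by
  obtain ⟨h1, h2, h3, h4, h5, h6, h7, h8, h9, h10, h11, h12, h13, h14⟩ := h
  have hor := min'_union_mem_and_le s.q1p s.q2
  have hub := min'_union_mem_and_le u.q1p u.q2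
  simp only [orStep, ubStep]
  cases hs : s.s2 <;> cases hu : u.s2 <;> simp only [] <;> (try split_ifs) <;>
    constructor <;> grind [Finset.not_nonempty_iff_eq_empty, Finset.union_eq_empty, Finset.erase_empty]

end NState.Dominated

/-- A job waiting less than `T` in the UB system is a past type-1 arrival whose threshold event
is still to come. -/
theorem mem_ubTraj_q1m (D : NDriving) {n b : ℕ} (hb : b ∈ (ubTraj D n).q1m) :
    1 ≤ b ∧ D.e b = .arr1 ∧ ∀ m, 1 ≤ m → m ≤ n → D.e m ≠ .thresh b := by
  induction n with
  | zero => simp [ubTraj, NState.empty] at hb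
  | succ n ih =>
    have key : (b ∈ (ubTraj D n).q1m ∧ D.e (n + 1) ≠ .thresh b) ∨
        (b = n + 1 ∧ D.e (n + 1) = .arr1) := by
      simp only [ubTraj] at hb
      cases he : D.e (n + 1) <;> simp only [he, ubStep] at hb <;> grind
    rcases key with ⟨hmem, hne⟩ | ⟨rfl, he⟩
    · obtain ⟨h1, h2, h3⟩ := ih hmem
      refine ⟨h1, h2, fun m hm hmn => ?_⟩
      rcases Nat.lt_or_eq_of_le hmn with hlt | rfl
      · exact h3 m hm (by omega)
      · exact hne
    · refine ⟨by omega, he, fun m hm hmn hth => ?_⟩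
      have := (D.hthresh m _ hm hth).2.1
      omega

/-- Thresholds are reached in order of arrival. -/
theorem le_of_mem_ubTraj_q1m_s7 (D : NDriving) {n k b : ℕ} (he : D.e (n + 1) = .thresh k)
    (hb : b ∈ (ubTraj D n).q1m) : k ≤ b := by
  obtain ⟨h1, h2, h3⟩ := mem_ubTraj_q1m D hb
  obtain ⟨m, hm, hem⟩ := D.hthresh_ex b h1 h2
  have hle : n + 1 ≤ m := by
    by_contra hlt
    exact h3 m hm (by omega) hem
  have htb := (D.hthresh m b hm hem).2.2.2
  have htk := (D.hthresh (n + 1) k (by omega) he).2.2.2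
  have := D.hmono.monotone hle
  exact D.hmono.le_iff_le.mp (by linarith)

theorem orTraj_dominated_ubTraj (D : NDriving) (n : ℕ) :
    NState.Dominated n (orTraj D n) (ubTraj D n) := by
  induction n with
  | zero => constructor <;> simp [orTraj, ubTraj, NState.empty]
  | succ n ih =>
    simp only [orTraj, ubTraj]
    cases he : D.e (n + 1) with
    | arr1 => exact ih.arr1
    | arr2 => exact ih.arr2
    | thresh k => exact ih.thresh fun b hb => le_of_mem_ubTraj_q1m_s7 D he hb
    | dep1 => exact ih.dep1
    | dep2 => exact ih.dep2

/-- For all `n ≥ 0`, the total number of waiting jobs in the OR system is at most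
that in the UB system: `Q₁(n) + Q₂(n) ≤ Q̂₁(n) + Q̂₂(n)`. -/
theorem total_queue_dominance (D : NDriving) (n : ℕ) :
    orQ1 D n + orQ2 D n ≤ ubQ1 D n + ubQ2 D n := by
  have h := orTraj_dominated_ubTraj D n
  exact Nat.add_le_add
    (Nat.add_le_add (Finset.card_le_card h.q1m_subset) (Finset.card_le_card h.q1p_subset))
    (Finset.card_le_card h.q2_subset)
end

section
/- Induction step for a type-2 arrival: suppose n ≥ 1 and that after the (n−1)-th event the following hold: 𝒬₁⁻(n−1) ⊆ 𝒬̂₁⁻(n−1), 𝒬₁⁺(n−1) ⊆ 𝒬̂₁⁺(n−1), 𝒬₂(n−1) ⊆ 𝒬̂₂(n−1), Q₁(n−1) + R₁(n−1) ≤ Q̂₁(n−1) + R̂₁(n−1), and R₂(n−1) + R₃(n−1) ≤ R̂₂(n−1) + R̂₃(n−1). If the n-th event e_n is of type (ii) (the arrival of a new type-2 job), then Q₁⁻(n) ≤ Q̂₁⁻(n), Q₁⁺(n) ≤ Q̂₁⁺(n), Q₂(n) ≤ Q̂₂(n), Q₁(n) + R₁(n) ≤ Q̂₁(n) + R̂₁(n),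 and R₂(n) + R₃(n) ≤ R̂₂(n) + R̂₃(n). -/
/-- Jobs in the type-1 queues are type-1 arrivals, jobs in the type-2 queue are type-2 arrivals,
and a job in service at server 2 is an arrival of one of the two types. -/
structure NState.JobsTyped (e : ℕ → NEvent) (s : NState) : Prop where
  q1m : ∀ j ∈ s.q1m, e j = NEvent.arr1
  q1p : ∀ j ∈ s.q1p, e j = NEvent.arr1
  q2 : ∀ j ∈ s.q2, e j = NEvent.arr2
  s2 : ∀ j, s.s2 = some j → e j = NEvent.arr1 ∨ e j = NEvent.arr2

/-- Server 2 is idle only if no job it may serve is waiting. -/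
def NState.NonIdling2 (s : NState) : Prop := s.s2 = none → s.q1p = ∅ ∧ s.q2 = ∅

theorem NState.JobsTyped.eq_of_mem_union {e : ℕ → NEvent} {s : NState} (h : s.JobsTyped e) {j : ℕ}
    (hj : j ∈ s.q1p ∪ s.q2) : e j = NEvent.arr1 ∨ e j = NEvent.arr2 :=
  (Finset.mem_union.mp hj).imp (h.q1p j) (h.q2 j)

theorem NState.JobsTyped.orStep {e : ℕ → NEvent} {s : NState} (h : s.JobsTyped e) (n : ℕ) :
    (orStep n (e n) s).JobsTyped e := by
  obtain ⟨h1, h2, h3, h4⟩ := id h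
  have hmin := fun hne => h.eq_of_mem_union ((s.q1p ∪ s.q2).min'_mem hne)
  cases he : e n <;> simp only [_root_.orStep] <;> repeat' split
  all_goals constructor <;> grind

theorem NState.JobsTyped.ubStep {e : ℕ → NEvent} {s : NState} (h : s.JobsTyped e) (n : ℕ) :
    (ubStep n (e n) s).JobsTyped e := by
  obtain ⟨h1, h2, h3, h4⟩ := id h
  have hmin := fun hne => h.eq_of_mem_union ((s.q1p ∪ s.q2).min'_mem hne)
  cases he : e n <;> simp only [_root_.ubStep] <;> repeat' split
  all_goals constructor <;> grind

theorem NState.NonIdling2.ubStep {s : NState} (h : s.NonIdling2) (n : ℕ) (ev : NEvent) :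
    (ubStep n ev s).NonIdling2 := by
  unfold NState.NonIdling2 at *
  cases ev <;> simp only [_root_.ubStep] <;> repeat' split
  all_goals grind [Finset.not_nonempty_iff_eq_empty, Finset.union_eq_empty]

theorem NState.jobsTyped_empty (e : ℕ → NEvent) : NState.empty.JobsTyped e := by
  constructor <;> simp [NState.empty]

theorem orTraj_jobsTyped (D : NDriving) (n : ℕ) : (orTraj D n).JobsTyped D.e := by
  induction n with
  | zero => exact NState.jobsTyped_empty D.e
  | succ n ih => exact ih.orStep (n + 1)

theorem ubTraj_jobsTyped (D : NDriving) (n : ℕ) : (ubTraj D n).JobsTyped D.e := by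
  induction n with
  | zero => exact NState.jobsTyped_empty D.e
  | succ n ih => exact ih.ubStep (n + 1)

theorem ubTraj_nonIdling2 (D : NDriving) (n : ℕ) : (ubTraj D n).NonIdling2 := by
  induction n with
  | zero => exact fun _ => ⟨rfl, rfl⟩
  | succ n ih => exact ih.ubStep (n + 1) (D.e (n + 1))

/-- `R₂ + R₃` is the indicator that server 2 is busy. -/
theorem orR2_add_orR3 (D : NDriving) (n : ℕ) :
    orR2 D n + orR3 D n = if (orTraj D n).s2 = none then 0 else 1 := by
  have h := (orTraj_jobsTyped D n).s2
  unfold orR2 orR3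
  cases hs : (orTraj D n).s2 with
  | none => simp
  | some j => rcases h j hs with h | h <;> simp [h]

/-- `R̂₂ + R̂₃` is the indicator that server 2 is busy. -/
theorem ubR2_add_ubR3 (D : NDriving) (n : ℕ) :
    ubR2 D n + ubR3 D n = if (ubTraj D n).s2 = none then 0 else 1 := by
  have h := (ubTraj_jobsTyped D n).s2
  unfold ubR2 ubR3
  cases hs : (ubTraj D n).s2 with
  | none => simp
  | some j => rcases h j hs with h | h <;> simp [h]

/-- Induction step of the dominance proof for a type-2 arrival (event of type (ii)).
Assume that after the `n`-th event: `𝒬₁⁻(n) ⊆ 𝒬̂₁⁻(n)`, `𝒬₁⁺(n) ⊆ 𝒬̂₁⁺(n)`,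
`𝒬₂(n) ⊆ 𝒬̂₂(n)`, `Q₁(n) + R₁(n) ≤ Q̂₁(n) + R̂₁(n)`, and
`R₂(n) + R₃(n) ≤ R̂₂(n) + R̂₃(n)`.  If the `(n+1)`-th event is a type-2 arrival (event of type (ii)), then
`Q₁⁻(n+1) ≤ Q̂₁⁻(n+1)`, `Q₁⁺(n+1) ≤ Q̂₁⁺(n+1)`, `Q₂(n+1) ≤ Q̂₂(n+1)`,
`Q₁(n+1) + R₁(n+1) ≤ Q̂₁(n+1) + R̂₁(n+1)`, and
`R₂(n+1) + R₃(n+1) ≤ R̂₂(n+1) + R̂₃(n+1)`. -/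
theorem step_arr2 (D : NDriving) (n : ℕ)
    (ih1 : (orTraj D n).q1m ⊆ (ubTraj D n).q1m)
    (ih2 : (orTraj D n).q1p ⊆ (ubTraj D n).q1p)
    (ih3 : (orTraj D n).q2 ⊆ (ubTraj D n).q2)
    (ih4 : orQ1 D n + orR1 D n ≤ ubQ1 D n + ubR1 D n)
    (ih5 : orR2 D n + orR3 D n ≤ ubR2 D n + ubR3 D n)
    (hev : D.e (n + 1) = NEvent.arr2) :
    orQ1m D (n + 1) ≤ ubQ1m D (n + 1) ∧
    orQ1p D (n + 1) ≤ ubQ1p D (n + 1) ∧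
    orQ2 D (n + 1) ≤ ubQ2 D (n + 1) ∧
    orQ1 D (n + 1) + orR1 D (n + 1) ≤ ubQ1 D (n + 1) + ubR1 D (n + 1) ∧
    orR2 D (n + 1) + orR3 D (n + 1) ≤ ubR2 D (n + 1) + ubR3 D (n + 1) := by
  have hni := ubTraj_nonIdling2 D n
  rw [orR2_add_orR3, ubR2_add_ubR3] at ih5 ⊢
  unfold NState.NonIdling2 at hni
  unfold orQ1 orR1 ubQ1 ubR1 orQ1m orQ1p ubQ1m ubQ1p at *
  unfold orQ2 ubQ2
  have hor : orTraj D (n + 1) = orStep (n + 1) NEvent.arr2 (orTraj D n) := hev ▸ rfl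
  have hub : ubTraj D (n + 1) = ubStep (n + 1) NEvent.arr2 (ubTraj D n) := hev ▸ rfl
  have c1 := Finset.card_le_card ih1
  have c2 := Finset.card_le_card ih2
  have c3 := Finset.card_le_card (Finset.insert_subset_insert (n + 1) ih3)
  simp only [orStep] at hor
  simp only [ubStep] at hub
  split at hor <;> rename_i ho <;> split at hub <;> rename_i hu <;> rw [hor, hub]
  · exact ⟨c1, c2, Finset.card_le_card ih3, ih4, by simp⟩
  · have hs : (ubTraj D n).s2 ≠ none := fun hs => hu ⟨hs, hni hs⟩
    exact ⟨c1, c2, by simp [ho.2.2], ih4, by simp [hs]⟩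
  · obtain ⟨hs, hp, hq⟩ := hu
    rw [hp, Finset.subset_empty] at ih2
    rw [hq, Finset.subset_empty] at ih3
    have hs' : (orTraj D n).s2 ≠ none := fun h => ho ⟨h, ih2, ih3⟩
    simp [hs, hs'] at ih5
  · exact ⟨c1, c2, c3, ih4, ih5⟩
end

section
/- Induction step for a threshold crossing: suppose n ≥ 1 and that after the (n−1)-th event the following hold: 𝒬₁⁻(n−1) ⊆ 𝒬̂₁⁻(n−1), 𝒬₁⁺(n−1) ⊆ 𝒬̂₁⁺(n−1), 𝒬₂(n−1) ⊆ 𝒬̂₂(n−1), Q₁(n−1) + R₁(n−1) ≤ Q̂₁(n−1) + R̂₁(n−1), and R₂(n−1) + R₃(n−1) ≤ R̂₂(n−1) + R̂₃(n−1). If the n-th event e_n is of type (iii) (the waiting time of a type-1 job c reaching the threshold T), then Q₁⁻(n) ≤ Q̂₁⁻(n), Q₁⁺(n) ≤ Q̂₁⁺(n), Q₂(n) ≤ Q̂₂(n), Q₁(n) + R₁(n) ≤ Q̂₁(n) + R̂₁(n), and R₂(n) + R₃(n) ≤ R̂₂(n) + R̂₃(n). -/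
/-- Job `k` is a type-1 job that has arrived, and not yet reached the threshold, by event `n`. -/
def Young (D : NDriving) (n k : ℕ) : Prop :=
  1 ≤ k ∧ k ≤ n ∧ D.e k = NEvent.arr1 ∧ ∀ m, 1 ≤ m → m ≤ n → D.e m ≠ NEvent.thresh k

theorem young_succ_iff (D : NDriving) (n k : ℕ) :
    Young D (n + 1) k ↔
      (Young D n k ∧ D.e (n + 1) ≠ NEvent.thresh k) ∨
        (k = n + 1 ∧ D.e (n + 1) = NEvent.arr1) := by
  constructor
  · rintro ⟨h1, h2, h3, h4⟩
    rcases Nat.lt_or_ge n k with h | h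
    · obtain rfl : k = n + 1 := by omega
      exact Or.inr ⟨rfl, h3⟩
    · exact Or.inl ⟨⟨h1, h, h3, fun m hm hmn => h4 m hm (by omega)⟩, h4 _ (by omega) le_rfl⟩
  · rintro (⟨⟨h1, h2, h3, h4⟩, h5⟩ | ⟨rfl, h⟩)
    · refine ⟨h1, by omega, h3, fun m hm hmn => ?_⟩
      rcases Nat.lt_or_ge n m with h | h
      · obtain rfl : m = n + 1 := by omega
        exact h5
      · exact h4 m hm h
    · refine ⟨by omega, le_rfl, h, fun m hm hmn hmt => ?_⟩
      have := (D.hthresh m _ hm hmt).2.1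
      omega

theorem young_of_thresh (D : NDriving) (n k : ℕ) (h : D.e (n + 1) = NEvent.thresh k) :
    Young D n k := by
  obtain ⟨h1, h2, h3, h4⟩ := D.hthresh _ _ (by omega) h
  refine ⟨h1, by omega, h3, fun m hm hmn hmt => ?_⟩
  have ht := (D.hthresh m k hm hmt).2.2.2
  have := D.hmono.injective (ht.trans h4.symm)
  omega

/-- Waiting jobs, and the job at server 2, have the type recorded by their arrival event. -/
structure WellTyped (D : NDriving) (s : NState) : Prop where
  q1m : ∀ k ∈ s.q1m, D.e k = NEvent.arr1
  q1p : ∀ k ∈ s.q1p, D.e k = NEvent.arr1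
  q2 : ∀ k ∈ s.q2, D.e k = NEvent.arr2
  s2 : ∀ k, s.s2 = some k → D.e k = NEvent.arr1 ∨ D.e k = NEvent.arr2

/-- In the UB system `q1m` holds exactly the young jobs, `q1p` holds none of them, and no
server idles while a job it may serve is waiting. -/
structure UBInv (D : NDriving) (n : ℕ) (s : NState) : Prop where
  mem_q1m : ∀ k, k ∈ s.q1m ↔ Young D n k
  q1p_old : ∀ k ∈ s.q1p, k ≤ n ∧ ¬ Young D n k
  idle1 : s.s1 = none → s.q1p = ∅
  idle2 : s.s2 = none → s.q1p = ∅ ∧ s.q2 = ∅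

/-- In the OR system the young jobs behind a waiting one are themselves waiting, and server 1
does not idle while a type-1 job is waiting. -/
structure ORInv (D : NDriving) (n : ℕ) (s : NState) : Prop where
  fcfs : ∀ c ∈ s.q1m, ∀ d, c < d → Young D n d → d ∈ s.q1m
  idle1 : s.s1 = none → s.q1m = ∅ ∧ s.q1p = ∅

theorem WellTyped.orStep {D : NDriving} {n : ℕ} {s : NState} (h : WellTyped D s) :
    WellTyped D (orStep n (D.e n) s) := by
  obtain ⟨h1, h2, h3, h4⟩ := h
  cases he : D.e n with
  | arr1 => simp only [_root_.orStep]; split_ifs <;> constructor <;> grind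
  | arr2 => simp only [_root_.orStep]; split_ifs <;> constructor <;> grind
  | thresh k => simp only [_root_.orStep]; split_ifs <;> constructor <;> grind
  | dep1 =>
    simp only [_root_.orStep]
    split
    · exact ⟨h1, h2, h3, h4⟩
    · split_ifs <;> constructor <;> grind
  | dep2 =>
    simp only [_root_.orStep]
    split
    · exact ⟨h1, h2, h3, h4⟩
    · split_ifs with hne
      · have hj := Finset.min'_mem _ hne
        constructor <;> grind
      · constructor <;> grind

theorem WellTyped.ubStep {D : NDriving} {n : ℕ} {s : NState} (h : WellTyped D s) :
    WellTyped D (ubStep n (D.e n) s) := by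
  obtain ⟨h1, h2, h3, h4⟩ := h
  cases he : D.e n with
  | arr1 => simp only [_root_.ubStep]; constructor <;> grind
  | arr2 => simp only [_root_.ubStep]; split_ifs <;> constructor <;> grind
  | thresh k => simp only [_root_.ubStep]; split_ifs <;> constructor <;> grind
  | dep1 =>
    simp only [_root_.ubStep]
    split
    · exact ⟨h1, h2, h3, h4⟩
    · split_ifs <;> constructor <;> grind
  | dep2 =>
    simp only [_root_.ubStep]
    split
    · exact ⟨h1, h2, h3, h4⟩
    · split_ifs with hne
      · have hj := Finset.min'_mem _ hne
        constructor <;> grind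
      · constructor <;> grind

theorem UBInv.ubStep {D : NDriving} {n : ℕ} {s : NState} (h : UBInv D n s) :
    UBInv D (n + 1) (ubStep (n + 1) (D.e (n + 1)) s) := by
  obtain ⟨h1, h2, h3, h4⟩ := h
  have hy := young_succ_iff D n
  cases he : D.e (n + 1) with
  | arr1 => simp only [_root_.ubStep]; constructor <;> grind
  | arr2 => simp only [_root_.ubStep]; split_ifs <;> constructor <;> grind
  | thresh k =>
    have hk := young_of_thresh D n k he
    have hkn := hk.2.1
    simp only [_root_.ubStep]; split_ifs <;> constructor <;> grind
  | dep1 =>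
    simp only [_root_.ubStep]
    split
    · constructor <;> grind
    · split_ifs <;> constructor <;> grind
  | dep2 =>
    simp only [_root_.ubStep]
    split
    · constructor <;> grind
    · split_ifs with hne
      · constructor <;> grind
      · rw [Finset.not_nonempty_iff_eq_empty, Finset.union_eq_empty] at hne
        constructor <;> grind

theorem ORInv.orStep {D : NDriving} {n : ℕ} {s : NState} (h : ORInv D n s) :
    ORInv D (n + 1) (orStep (n + 1) (D.e (n + 1)) s) := by
  obtain ⟨h1, h2⟩ := h
  have hy := young_succ_iff D n
  have hle : ∀ k, Young D n k → k ≤ n := fun k hk => hk.2.1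
  cases he : D.e (n + 1) with
  | arr1 => simp only [_root_.orStep]; split_ifs <;> constructor <;> grind
  | arr2 => simp only [_root_.orStep]; split_ifs <;> constructor <;> grind
  | thresh k => simp only [_root_.orStep]; split_ifs <;> constructor <;> grind
  | dep1 =>
    simp only [_root_.orStep]
    split
    · constructor <;> grind
    · split_ifs with hne
      · have hmin : ∀ k ∈ s.q1m, (s.q1m ∪ s.q1p).min' hne ≤ k := fun k hk =>
          Finset.min'_le _ k (Finset.mem_union_left _ hk)
        constructor <;> grind
      · rw [Finset.not_nonempty_iff_eq_empty, Finset.union_eq_empty] at hne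
        constructor <;> grind
  | dep2 =>
    simp only [_root_.orStep]
    split
    · constructor <;> grind
    · split_ifs <;> constructor <;> grind

theorem wellTyped_empty (D : NDriving) : WellTyped D NState.empty := by
  constructor <;> simp [NState.empty]

theorem orTraj_wellTyped (D : NDriving) (n : ℕ) : WellTyped D (orTraj D n) := by
  induction n with
  | zero => exact wellTyped_empty D
  | succ n ih => exact ih.orStep

theorem ubTraj_wellTyped (D : NDriving) (n : ℕ) : WellTyped D (ubTraj D n) := by
  induction n with
  | zero => exact wellTyped_empty D
  | succ n ih => exact ih.ubStep

theorem orTraj_inv (D : NDriving) (n : ℕ) : ORInv D n (orTraj D n) := by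
  induction n with
  | zero => constructor <;> simp [orTraj, NState.empty]
  | succ n ih => exact ih.orStep

theorem ubTraj_inv (D : NDriving) (n : ℕ) : UBInv D n (ubTraj D n) := by
  induction n with
  | zero =>
    have hy : ∀ k, ¬ Young D 0 k := fun k hk => by
      have := hk.1
      have := hk.2.1
      omega
    constructor <;> simp [ubTraj, NState.empty, hy]
  | succ n ih => exact ih.ubStep

/-- Young jobs reach the threshold in order of arrival. -/
theorem le_of_young_of_thresh {D : NDriving} {n c d : ℕ}
    (hc : D.e (n + 1) = NEvent.thresh c) (hd : Young D n d) : c ≤ d := by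
  obtain ⟨h1, -, h3, h4⟩ := hd
  obtain ⟨m, hm, hmd⟩ := D.hthresh_ex d h1 h3
  have hnm : n + 1 ≤ m := by
    by_contra hlt
    exact h4 m hm (by omega) hmd
  have hc' := (D.hthresh _ _ (by omega) hc).2.2.2
  have hd' := (D.hthresh _ _ hm hmd).2.2.2
  have := D.hmono.monotone hnm
  exact D.hmono.le_iff_le.1 (by linarith)


/-- Induction step of the dominance proof for a threshold crossing (event of type (iii): the waiting time of a type-1 job `c` reaching `T`).
Assume that after the `n`-th event: `𝒬₁⁻(n) ⊆ 𝒬̂₁⁻(n)`, `𝒬₁⁺(n) ⊆ 𝒬̂₁⁺(n)`,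
`𝒬₂(n) ⊆ 𝒬̂₂(n)`, `Q₁(n) + R₁(n) ≤ Q̂₁(n) + R̂₁(n)`, and
`R₂(n) + R₃(n) ≤ R̂₂(n) + R̂₃(n)`.  If the `(n+1)`-th event is a threshold crossing (event of type (iii): the waiting time of a type-1 job `c` reaching `T`), then
`Q₁⁻(n+1) ≤ Q̂₁⁻(n+1)`, `Q₁⁺(n+1) ≤ Q̂₁⁺(n+1)`, `Q₂(n+1) ≤ Q̂₂(n+1)`,
`Q₁(n+1) + R₁(n+1) ≤ Q̂₁(n+1) + R̂₁(n+1)`, and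
`R₂(n+1) + R₃(n+1) ≤ R̂₂(n+1) + R̂₃(n+1)`. -/
theorem step_thresh (D : NDriving) (n : ℕ)
    (ih1 : (orTraj D n).q1m ⊆ (ubTraj D n).q1m)
    (ih2 : (orTraj D n).q1p ⊆ (ubTraj D n).q1p)
    (ih3 : (orTraj D n).q2 ⊆ (ubTraj D n).q2)
    (ih4 : orQ1 D n + orR1 D n ≤ ubQ1 D n + ubR1 D n)
    (ih5 : orR2 D n + orR3 D n ≤ ubR2 D n + ubR3 D n)
    (hev : ∃ c, D.e (n + 1) = NEvent.thresh c) :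
    orQ1m D (n + 1) ≤ ubQ1m D (n + 1) ∧
    orQ1p D (n + 1) ≤ ubQ1p D (n + 1) ∧
    orQ2 D (n + 1) ≤ ubQ2 D (n + 1) ∧
    orQ1 D (n + 1) + orR1 D (n + 1) ≤ ubQ1 D (n + 1) + ubR1 D (n + 1) ∧
    orR2 D (n + 1) + orR3 D (n + 1) ≤ ubR2 D (n + 1) + ubR3 D (n + 1) := by
  obtain ⟨c, hc⟩ := hev
  have ho := orTraj_inv D n
  have hu := ubTraj_inv D n
  have hcu : c ∈ (ubTraj D n).q1m := (hu.mem_q1m c).2 (young_of_thresh D n c hc)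
  have hcup : c ∉ (ubTraj D n).q1p := fun h =>
    (hu.q1p_old c h).2 (young_of_thresh D n c hc)
  have hsame : c ∈ (orTraj D n).q1m → (orTraj D n).q1m = (ubTraj D n).q1m := fun h => by
    refine ih1.antisymm fun d hd => ?_
    have hy := (hu.mem_q1m d).1 hd
    rcases (le_of_young_of_thresh hc hy).eq_or_lt with rfl | hlt
    · exact h
    · exact ho.fcfs c h d hlt hy
  have ho1 := ho.idle1
  have hu1 := hu.idle1
  have hu2 := hu.idle2
  have hcard2 := Finset.card_le_card ih2
  have hcard3 := Finset.card_le_card ih3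
  rw [orR2_add_orR3, ubR2_add_ubR3] at *
  simp only [orQ1, orQ1m, orQ1p, orQ2, orR1, ubQ1, ubQ1m, ubQ1p, ubQ2, ubR1] at *
  simp only [orTraj, ubTraj, hc, orStep, ubStep]
  generalize orTraj D n = s at *
  generalize ubTraj D n = u at *
  by_cases hco : c ∈ s.q1m
  · have hs1 : s.s1 ≠ none := fun h => by simp [(ho1 h).1] at hco
    have hq := hsame hco
    have hus1 : u.s1 ≠ none := fun h => by
      simp [hs1, h, hu1 h, hq] at ih4
    rw [hq] at ih4 ⊢
    simp only [hcu, hs1, hus1, if_true, false_and, if_false] at *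
    split_ifs <;> grind
  · have hsub : s.q1m ⊆ u.q1m.erase c := by grind
    have hcard1 := Finset.card_le_card hsub
    simp only [hcu, hco, if_true, if_false] at *
    split_ifs at * <;> grind
end

section
/- Induction step for a potential completion at server 1: suppose n ≥ 1 and that after the (n−1)-th event the following hold: 𝒬₁⁻(n−1) ⊆ 𝒬̂₁⁻(n−1), 𝒬₁⁺(n−1) ⊆ 𝒬̂₁⁺(n−1), 𝒬₂(n−1) ⊆ 𝒬̂₂(n−1), Q₁(n−1) + R₁(n−1) ≤ Q̂₁(n−1) + R̂₁(n−1), and R₂(n−1) + R₃(n−1) ≤ R̂₂(n−1) + R̂₃(n−1). If the n-th event e_n is of type (iv) (a potential service completion at server 1), then Q₁⁻(n) ≤ Q̂₁⁻(n), Q₁⁺(n) ≤ Q̂₁⁺(n), Q₂(n) ≤ Q̂₂(n), Q₁(n) + R₁(n) ≤ Q̂₁(n) + R̂₁(n), and R₂(n) + R₃(n) ≤ R̂₂(n) + R̂₃(n). -/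
theorem mem_q1m_of_mem_orStep_q1m {n j : ℕ} {ev : NEvent} {s : NState}
    (h : j ∈ (orStep n ev s).q1m) :
    (j ∈ s.q1m ∧ ev ≠ NEvent.thresh j) ∨ (j = n ∧ ev = NEvent.arr1) := by
  unfold orStep at h
  grind

theorem mem_q1p_of_mem_orStep_q1p {n j : ℕ} {ev : NEvent} {s : NState}
    (h : j ∈ (orStep n ev s).q1p) : j ∈ s.q1p ∨ ev = NEvent.thresh j := by
  unfold orStep at h
  grind

/-- Server 1 of the OR system is non-idling: it is idle only if no type-1 job waits. -/
theorem orTraj_q1_eq_empty_of_s1_eq_none (D : NDriving) (n : ℕ) (h : (orTraj D n).s1 = none) :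
    (orTraj D n).q1m = ∅ ∧ (orTraj D n).q1p = ∅ := by
  induction n with
  | zero => exact ⟨rfl, rfl⟩
  | succ n ih =>
    rw [orTraj] at h ⊢
    generalize orTraj D n = s at *
    unfold orStep at *
    grind [Finset.not_nonempty_iff_eq_empty, Finset.union_eq_empty]

theorem arr1_of_mem_orTraj_q1m (D : NDriving) {n j : ℕ} (h : j ∈ (orTraj D n).q1m) :
    1 ≤ j ∧ D.e j = NEvent.arr1 ∧ ∀ m, 1 ≤ m → m ≤ n → D.e m ≠ NEvent.thresh j := by
  induction n with
  | zero => simp [orTraj, NState.empty] at h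
  | succ n ih =>
    rcases mem_q1m_of_mem_orStep_q1m h with ⟨hj, hne⟩ | ⟨rfl, hev⟩
    · obtain ⟨h1, harr, hall⟩ := ih hj
      refine ⟨h1, harr, fun m hm hmn => ?_⟩
      rcases Nat.le_succ_iff.mp hmn with hle | rfl
      · exact hall m hm hle
      · exact hne
    · refine ⟨by omega, hev, fun m hm hmn he => ?_⟩
      have := (D.hthresh m _ hm he).2.1
      omega

theorem exists_thresh_of_mem_orTraj_q1p (D : NDriving) {n j : ℕ} (h : j ∈ (orTraj D n).q1p) :
    ∃ m, 1 ≤ m ∧ m ≤ n ∧ D.e m = NEvent.thresh j := by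
  induction n with
  | zero => simp [orTraj, NState.empty] at h
  | succ n ih =>
    rcases mem_q1p_of_mem_orStep_q1p h with hj | hev
    · obtain ⟨m, h1, hmn, he⟩ := ih hj
      exact ⟨m, h1, by omega, he⟩
    · exact ⟨n + 1, by omega, le_rfl, hev⟩

/-- In the OR system, type-1 jobs past the threshold arrived before those still below it. -/
theorem lt_of_mem_orTraj_q1p_of_mem_orTraj_q1m (D : NDriving) {n k j : ℕ}
    (hk : k ∈ (orTraj D n).q1p) (hj : j ∈ (orTraj D n).q1m) : k < j := by
  obtain ⟨m, hm, hmn, he⟩ := exists_thresh_of_mem_orTraj_q1p D hk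
  obtain ⟨hj1, harr, hall⟩ := arr1_of_mem_orTraj_q1m D hj
  obtain ⟨m', hm', he'⟩ := D.hthresh_ex j hj1 harr
  have hlt : m < m' := by
    by_contra! hle
    exact hall m' hm' (hle.trans hmn) he'
  have htk := (D.hthresh m k hm he).2.2.2
  have htj := (D.hthresh m' j hm' he').2.2.2
  have := D.hmono hlt
  exact D.hmono.lt_iff_lt.mp (by linarith)

theorem orStep_dep1_q1m_subset (n : ℕ) (s : NState) :
    (orStep n NEvent.dep1 s).q1m ⊆ s.q1m := fun _ h => by
  simpa using mem_q1m_of_mem_orStep_q1m h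

theorem orStep_dep1_q2 (n : ℕ) (s : NState) : (orStep n NEvent.dep1 s).q2 = s.q2 := by
  simp only [orStep]; grind

theorem orStep_dep1_s2 (n : ℕ) (s : NState) : (orStep n NEvent.dep1 s).s2 = s.s2 := by
  simp only [orStep]; grind

theorem ubStep_dep1_q1m (n : ℕ) (s : NState) : (ubStep n NEvent.dep1 s).q1m = s.q1m := by
  simp only [ubStep]; grind

theorem ubStep_dep1_q2 (n : ℕ) (s : NState) : (ubStep n NEvent.dep1 s).q2 = s.q2 := by
  simp only [ubStep]; grind

theorem ubStep_dep1_s2 (n : ℕ) (s : NState) : (ubStep n NEvent.dep1 s).s2 = s.s2 := by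
  simp only [ubStep]; grind

/-- A potential completion at server 1 removes at most one job from `q1p` in the UB system. -/
theorem card_q1p_le_ubStep_dep1 (n : ℕ) (s : NState) :
    s.q1p.card - 1 ≤ (ubStep n NEvent.dep1 s).q1p.card := by
  simp only [ubStep]
  split
  · omega
  · split
    · exact Finset.pred_card_le_card_erase
    · exact Nat.sub_le _ _

/-- If server 1 is non-idling and `q1p` precedes `q1m`, then a potential completion at server 1
in the OR system takes a job of `q1p` into service whenever there is one. -/
theorem orStep_dep1_card_q1p_le (n : ℕ) (s : NState) (hidle : s.s1 = none → s.q1p = ∅)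
    (hlt : ∀ k ∈ s.q1p, ∀ j ∈ s.q1m, k < j) :
    (orStep n NEvent.dep1 s).q1p.card ≤ s.q1p.card - 1 := by
  rcases s.q1p.eq_empty_or_nonempty with hp | ⟨k, hk⟩
  · have : (orStep n NEvent.dep1 s).q1p = ∅ := by
      refine Finset.subset_empty.mp fun j hj => ?_
      simpa [hp] using mem_q1p_of_mem_orStep_q1p hj
    simp [this]
  · have hne : (s.q1m ∪ s.q1p).Nonempty := ⟨k, Finset.mem_union_right _ hk⟩
    have hmem : (s.q1m ∪ s.q1p).min' hne ∈ s.q1p := by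
      rcases Finset.mem_union.mp (Finset.min'_mem _ hne) with h | h
      · exact absurd (Finset.min'_le _ k (Finset.mem_union_right _ hk)) (hlt k hk _ h).not_ge
      · exact h
    simp only [orStep]
    split
    · next h => simp [hidle h] at hk
    · simp only [dif_pos hne]
      exact (Finset.card_erase_of_mem hmem).le

/-- A potential completion at server 1 lowers the number of type-1 jobs waiting or at server 1
of the OR system, if that server is busy. -/
theorem orStep_dep1_card_lt (n : ℕ) (s : NState) (h1 : s.s1 ≠ none) :
    (orStep n NEvent.dep1 s).q1m.card + (orStep n NEvent.dep1 s).q1p.card +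
      (if (orStep n NEvent.dep1 s).s1 = none then 0 else 1) <
      s.q1m.card + s.q1p.card + 1 := by
  simp only [orStep]
  split
  · contradiction
  · split
    · next hne =>
      have hm := Finset.card_erase_le (s := s.q1m) (a := (s.q1m ∪ s.q1p).min' hne)
      have hp := Finset.card_erase_le (s := s.q1p) (a := (s.q1m ∪ s.q1p).min' hne)
      rcases Finset.mem_union.mp (Finset.min'_mem _ hne) with h | h
      · have := Finset.card_erase_lt_of_mem h
        simp; omega
      · have := Finset.card_erase_lt_of_mem h
        simp; omega
    · simp

/-- A potential completion at server 1 lowers the number of type-1 jobs waiting or at server 1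
of the UB system by at most one. -/
theorem card_le_ubStep_dep1_card_add_one (n : ℕ) (s : NState) :
    s.q1m.card + s.q1p.card + (if s.s1 = none then 0 else 1) ≤
      (ubStep n NEvent.dep1 s).q1m.card + (ubStep n NEvent.dep1 s).q1p.card +
        (if (ubStep n NEvent.dep1 s).s1 = none then 0 else 1) + 1 := by
  rcases h : s.s1 with _ | b
  · simp [ubStep, h]
  · by_cases hne : s.q1p.Nonempty
    · have := Finset.pred_card_le_card_erase (s := s.q1p) (a := s.q1p.min' hne)
      simp only [ubStep, h, dif_pos hne, reduceCtorEq, if_false]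
      omega
    · simp [ubStep, h, hne]

/-- Induction step of the dominance proof for a potential service completion at server 1 (event of type (iv)).
Assume that after the `n`-th event: `𝒬₁⁻(n) ⊆ 𝒬̂₁⁻(n)`, `𝒬₁⁺(n) ⊆ 𝒬̂₁⁺(n)`,
`𝒬₂(n) ⊆ 𝒬̂₂(n)`, `Q₁(n) + R₁(n) ≤ Q̂₁(n) + R̂₁(n)`, and
`R₂(n) + R₃(n) ≤ R̂₂(n) + R̂₃(n)`.  If the `(n+1)`-th event is a potential service completion at server 1 (event of type (iv)), then
`Q₁⁻(n+1) ≤ Q̂₁⁻(n+1)`, `Q₁⁺(n+1) ≤ Q̂₁⁺(n+1)`, `Q₂(n+1) ≤ Q̂₂(n+1)`,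
`Q₁(n+1) + R₁(n+1) ≤ Q̂₁(n+1) + R̂₁(n+1)`, and
`R₂(n+1) + R₃(n+1) ≤ R̂₂(n+1) + R̂₃(n+1)`. -/
theorem step_dep1 (D : NDriving) (n : ℕ)
    (ih1 : (orTraj D n).q1m ⊆ (ubTraj D n).q1m)
    (ih2 : (orTraj D n).q1p ⊆ (ubTraj D n).q1p)
    (ih3 : (orTraj D n).q2 ⊆ (ubTraj D n).q2)
    (ih4 : orQ1 D n + orR1 D n ≤ ubQ1 D n + ubR1 D n)
    (ih5 : orR2 D n + orR3 D n ≤ ubR2 D n + ubR3 D n)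
    (hev : D.e (n + 1) = NEvent.dep1) :
    orQ1m D (n + 1) ≤ ubQ1m D (n + 1) ∧
    orQ1p D (n + 1) ≤ ubQ1p D (n + 1) ∧
    orQ2 D (n + 1) ≤ ubQ2 D (n + 1) ∧
    orQ1 D (n + 1) + orR1 D (n + 1) ≤ ubQ1 D (n + 1) + ubR1 D (n + 1) ∧
    orR2 D (n + 1) + orR3 D (n + 1) ≤ ubR2 D (n + 1) + ubR3 D (n + 1) := by
  have hor : orTraj D (n + 1) = orStep (n + 1) NEvent.dep1 (orTraj D n) := by rw [orTraj, hev]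
  have hub : ubTraj D (n + 1) = ubStep (n + 1) NEvent.dep1 (ubTraj D n) := by rw [ubTraj, hev]
  refine ⟨?_, ?_, ?_, ?_, ?_⟩
  · rw [orQ1m, ubQ1m, hor, hub, ubStep_dep1_q1m]
    exact Finset.card_le_card ((orStep_dep1_q1m_subset _ _).trans ih1)
  · rw [orQ1p, ubQ1p, hor, hub]
    calc _ ≤ (orTraj D n).q1p.card - 1 := orStep_dep1_card_q1p_le _ _
            (fun h => (orTraj_q1_eq_empty_of_s1_eq_none D n h).2)
            (fun _ hk _ hj => lt_of_mem_orTraj_q1p_of_mem_orTraj_q1m D hk hj)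
      _ ≤ (ubTraj D n).q1p.card - 1 := Nat.sub_le_sub_right (Finset.card_le_card ih2) 1
      _ ≤ _ := card_q1p_le_ubStep_dep1 _ _
  · rw [orQ2, ubQ2, hor, hub, orStep_dep1_q2, ubStep_dep1_q2]
    exact Finset.card_le_card ih3
  · simp only [orQ1, orQ1m, orQ1p, orR1, ubQ1, ubQ1m, ubQ1p, ubR1, hor, hub] at ih4 ⊢
    by_cases h1 : (orTraj D n).s1 = none
    · obtain ⟨hm, hp⟩ := orTraj_q1_eq_empty_of_s1_eq_none D n h1
      have hs : orStep (n + 1) NEvent.dep1 (orTraj D n) = orTraj D n := by simp [orStep, h1]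
      simp [hs, hm, hp, h1]
    · rw [if_neg h1] at ih4
      have hlt := orStep_dep1_card_lt (n + 1) _ h1
      have hle := card_le_ubStep_dep1_card_add_one (n + 1) (ubTraj D n)
      omega
  · simpa only [orR2, orR3, ubR2, ubR3, hor, hub, orStep_dep1_s2, ubStep_dep1_s2] using ih5
end

section
/- Characterization of the pre-threshold queue in the UB system: for all n ≥ 1, 𝒬̂₁⁻(n) is exactly the set of type-1 jobs j whose arrival time α_j satisfies t_n − T < α_j ≤ t_n; in particular, Q̂₁⁻(n) equals the number of type-1 arrivals in the time interval (t_n − T, t_n]. -/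
/-- The pre-threshold queue changes only by the arrival of a type-1 job or by a job of it
reaching the threshold. -/
theorem mem_ubStep_q1m (n : ℕ) (ev : NEvent) (s : NState) (j : ℕ) :
    j ∈ (ubStep n ev s).q1m ↔
      (ev = NEvent.arr1 ∧ j = n) ∨ (j ∈ s.q1m ∧ ev ≠ NEvent.thresh j) := by
  cases ev <;> simp only [ubStep] <;> (repeat' split) <;> grind

/-- A type-1 job is in the pre-threshold queue of the UB system exactly from its arrival
until its threshold event. -/
theorem mem_ubTraj_q1m_iff_lt_thresh (D : NDriving) {j m : ℕ} (hj : 1 ≤ j)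
    (harr : D.e j = NEvent.arr1) (hm : 1 ≤ m) (hthr : D.e m = NEvent.thresh j) (n : ℕ) :
    j ∈ (ubTraj D n).q1m ↔ j ≤ n ∧ n < m := by
  have hunique : ∀ m', 1 ≤ m' → D.e m' = NEvent.thresh j → m' = m := fun m' hm' h =>
    D.hmono.injective
      ((D.hthresh m' j hm' h).2.2.2.trans (D.hthresh m j hm hthr).2.2.2.symm)
  have hjm : j < m := (D.hthresh m j hm hthr).2.1
  induction n with
  | zero => simp [ubTraj, NState.empty]; omega
  | succ n ih =>
    have hnext := hunique (n + 1) (by omega)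
    rw [ubTraj, mem_ubStep_q1m]
    grind

/-- Only type-1 jobs that have arrived are in the pre-threshold queue of the UB system. -/
theorem arr1_of_mem_ubTraj_q1m (D : NDriving) {n j : ℕ} (h : j ∈ (ubTraj D n).q1m) :
    1 ≤ j ∧ D.e j = NEvent.arr1 := by
  induction n with
  | zero => simp [ubTraj, NState.empty] at h
  | succ n ih =>
    rw [ubTraj, mem_ubStep_q1m] at h
    grind

open Classical in
/-- Characterization of the pre-threshold queue in the UB system: for `n ≥ 1`,
`𝒬̂₁⁻(n)` is exactly the set of type-1 jobs `j` whose arrival time `α_j = t j`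
satisfies `t n - T < α_j ≤ t n`; in particular, `Q̂₁⁻(n)` equals the number of
type-1 arrivals in the time interval `(t n - T, t n]`. -/
theorem ub_preThreshold_characterization (D : NDriving) (n : ℕ) (hn : 1 ≤ n) :
    (∀ j : ℕ, j ∈ (ubTraj D n).q1m ↔
      (1 ≤ j ∧ D.e j = NEvent.arr1 ∧ D.t n - D.T < D.t j ∧ D.t j ≤ D.t n)) ∧
    ubQ1m D n = ((Finset.range (n + 1)).filter
      (fun j => 1 ≤ j ∧ D.e j = NEvent.arr1 ∧ D.t n - D.T < D.t j ∧ D.t j ≤ D.t n)).card := by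
  have hmem : ∀ j : ℕ, j ∈ (ubTraj D n).q1m ↔
      (1 ≤ j ∧ D.e j = NEvent.arr1 ∧ D.t n - D.T < D.t j ∧ D.t j ≤ D.t n) := by
    intro j
    by_cases hj : 1 ≤ j ∧ D.e j = NEvent.arr1
    · obtain ⟨hj, harr⟩ := hj
      obtain ⟨m, hm, hthr⟩ := D.hthresh_ex j hj harr
      have htm := (D.hthresh m j hm hthr).2.2.2
      rw [mem_ubTraj_q1m_iff_lt_thresh D hj harr hm hthr, sub_lt_iff_lt_add, ← htm,
        D.hmono.lt_iff_lt, D.hmono.le_iff_le]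
      tauto
    · exact ⟨fun h => absurd (arr1_of_mem_ubTraj_q1m D h) hj, fun h => absurd ⟨h.1, h.2.1⟩ hj⟩
  refine ⟨hmem, congrArg Finset.card (Finset.ext fun j => ?_)⟩
  rw [hmem, Finset.mem_filter, Finset.mem_range, Nat.lt_succ_iff]
  exact ⟨fun h => ⟨D.hmono.le_iff_le.mp h.2.2.2, h⟩, And.right⟩
end
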